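/- For every n ≥ 3 there exist constants C > 0 and ε > 0 such that for all t ∈ (0, ε), the first nonzero eigenvalue of the Fujiwara Laplacian of the cycle C_n with the edge-length function l_t satisfies λ₁(C_n, l_t) ≥ C/t. In particular λ₁(C_n, l_t) → ∞ as t → 0⁺. -/

import Mathlib

open Finset Filter Topology
open scoped Classical ENNReal

noncomputable section

variable {V : Type*} [Fintype V]

/-- The set of neighbors of `u` as a `Finset`. -/
def nbr (G : SimpleGraph V) (u : V) : Finset V :=
  Finset.univ.filter (fun v => G.Adj u v)

/-- The vertex-weight `m₀(u) = ∑_{v ∼ u} l(uv)` induced by the edge-length function `l`. -/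
def m0 (G : SimpleGraph V) (l : V → V → ℝ) (u : V) : ℝ :=
  ∑ v ∈ nbr G u, l u v

/-- The Fujiwara Laplacian `(Δ_l φ)(u) = ∑_{v ∼ u} (m₁(uv)/m₀(u)) (φ(u) − φ(v))`,
where `m₁(uv) = 1/l(uv)`. -/
def lap (G : SimpleGraph V) (l : V → V → ℝ) (φ : V → ℝ) (u : V) : ℝ :=
  ∑ v ∈ nbr G u, ((1 / l u v) / m0 G l u) * (φ u - φ v)

/-- `l` is an edge-length function: symmetric and positive on adjacent pairs. -/
def IsLength (G : SimpleGraph V) (l : V → V → ℝ) : Prop :=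
  (∀ u v, l u v = l v u) ∧ ∀ u v, G.Adj u v → 0 < l u v

/-- The Dirichlet energy `∑_{uv ∈ E} m₁(uv) (φ(u) − φ(v))²`
(each edge counted once, via half the sum over ordered adjacent pairs). -/
def energy (G : SimpleGraph V) (l : V → V → ℝ) (φ : V → ℝ) : ℝ :=
  (1/2) * ∑ u, ∑ v ∈ nbr G u, (1 / l u v) * (φ u - φ v) ^ 2

/-- The squared norm `∑_{u ∈ V} m₀(u) φ(u)²`. -/
def mass (G : SimpleGraph V) (l : V → V → ℝ) (φ : V → ℝ) : ℝ :=
  ∑ u, m0 G l u * φ u ^ 2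

/-- The first nonzero eigenvalue of the Fujiwara Laplacian, via its variational
characterization as the infimum of the Rayleigh quotient over nonzero functions
orthogonal to the constants. -/
def lambda1 (G : SimpleGraph V) (l : V → V → ℝ) : ℝ :=
  sInf { r | ∃ φ : V → ℝ, φ ≠ 0 ∧ (∑ u, m0 G l u * φ u) = 0 ∧
    r = energy G l φ / mass G l φ }

/-- The largest eigenvalue of the Fujiwara Laplacian, via its variational
characterization as the supremum of the Rayleigh quotient. -/
def lambdaMax (G : SimpleGraph V) (l : V → V → ℝ) : ℝ :=
  sSup { r | ∃ φ : V → ℝ, φ ≠ 0 ∧ r = energy G l φ / mass G l φ }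

/-- `Λ₁(G)`: the supremum, in `[0, ∞]`, of `λ₁(G, l)` over all edge-length functions `l`
normalized by `∑_{u ∈ V} m₀(u) = 1`. -/
def Lambda1 (G : SimpleGraph V) : ℝ≥0∞ :=
  ⨆ (l : V → V → ℝ) (_ : IsLength G l ∧ (∑ u, m0 G l u) = 1),
    ENNReal.ofReal (lambda1 G l)

/-- `μ` is the nondecreasing sequence of eigenvalues (with multiplicity) of the
Fujiwara Laplacian `Δ_l`: it is monotone and admits a corresponding family of
eigenfunctions that is orthonormal for the inner product `⟨φ, ψ⟩ = ∑ m₀(u) φ(u) ψ(u)`. -/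
def IsLapEigSeq (G : SimpleGraph V) (l : V → V → ℝ)
    (μ : Fin (Fintype.card V) → ℝ) : Prop :=
  Monotone μ ∧ ∃ φ : Fin (Fintype.card V) → V → ℝ,
    (∀ i u, lap G l (φ i) u = μ i * φ i u) ∧
    (∀ i j, (∑ u, m0 G l u * φ i u * φ j u) = if i = j then 1 else 0)


/-- The edge-length function `l_t` on the cycle graph `C_n` (vertices `0, …, n−1`
corresponding to `1, …, n`): the edge `{n−2, n−1}` (i.e. `{n−1, n}` in `1`-based labels)
has length `1`, and all other edges (`{i, i+1}` for `0 ≤ i ≤ n−3`, and `{n−1, 0}`)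
have length `t`. -/
def cycleLen (n : ℕ) (t : ℝ) (i j : Fin n) : ℝ :=
  if (i.val = n - 2 ∧ j.val = n - 1) ∨ (i.val = n - 1 ∧ j.val = n - 2) then 1 else t

lemma m0_pos (G : SimpleGraph V) {l : V → V → ℝ} (hl : ∀ u v, 0 < l u v) {u v : V}
    (huv : G.Adj u v) : 0 < m0 G l u :=
  Finset.sum_pos (fun _ _ => hl _ _) ⟨v, by simpa [nbr] using huv⟩

lemma m0_le_card (G : SimpleGraph V) {l : V → V → ℝ} (hl : ∀ u v, l u v ≤ 1) (u : V) :
    m0 G l u ≤ Fintype.card V := by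
  have h : m0 G l u ≤ (nbr G u).card • (1 : ℝ) := Finset.sum_le_card_nsmul _ _ _ fun v _ => hl u v
  have hc : ((nbr G u).card : ℝ) ≤ Fintype.card V := by exact_mod_cast Finset.card_le_univ _
  simpa using h.trans (by simpa using hc)

lemma energy_nonneg (G : SimpleGraph V) {l : V → V → ℝ} (hl : ∀ u v, 0 < l u v) (φ : V → ℝ) :
    0 ≤ energy G l φ := by
  have h : ∀ u v, 0 ≤ 1 / l u v * (φ u - φ v) ^ 2 := fun u v => by
    have := hl u v
    positivity
  exact mul_nonneg (by norm_num) (Finset.sum_nonneg fun u _ => Finset.sum_nonneg fun v _ => h u v)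

/-- The energy controls the increment of a function along each edge. -/
lemma sq_sub_le_energy (G : SimpleGraph V) {l : V → V → ℝ} (hl : ∀ u v, 0 < l u v) (φ : V → ℝ)
    {u v : V} (huv : G.Adj u v) : (φ u - φ v) ^ 2 ≤ 2 * l u v * energy G l φ := by
  have h : ∀ u v, 0 ≤ 1 / l u v * (φ u - φ v) ^ 2 := fun u v => by
    have := hl u v
    positivity
  have hv : 1 / l u v * (φ u - φ v) ^ 2 ≤ ∑ w ∈ nbr G u, 1 / l u w * (φ u - φ w) ^ 2 :=
    Finset.single_le_sum (f := fun w => 1 / l u w * (φ u - φ w) ^ 2) (fun w _ => h u w)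
      (by simpa [nbr] using huv)
  have hu : ∑ w ∈ nbr G u, 1 / l u w * (φ u - φ w) ^ 2 ≤ 2 * energy G l φ := by
    have := Finset.single_le_sum (f := fun x => ∑ w ∈ nbr G x, 1 / l x w * (φ x - φ w) ^ 2)
      (fun x _ => Finset.sum_nonneg fun w _ => h x w) (Finset.mem_univ u)
    unfold energy
    linarith
  have hpos := hl u v
  calc (φ u - φ v) ^ 2 = l u v * (1 / l u v * (φ u - φ v) ^ 2) := by field_simp
    _ ≤ l u v * (2 * energy G l φ) := mul_le_mul_of_nonneg_left (hv.trans hu) hpos.le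
    _ = 2 * l u v * energy G l φ := by ring

/-- Among the translates of a function by constants, the mean-zero one has the least mass. -/
lemma mass_le_sum_sq_sub (G : SimpleGraph V) {l : V → V → ℝ} (hm : ∀ u, 0 ≤ m0 G l u)
    {φ : V → ℝ} (hφ : ∑ u, m0 G l u * φ u = 0) (c : ℝ) :
    mass G l φ ≤ ∑ u, m0 G l u * (φ u - c) ^ 2 := by
  have h : ∑ u, m0 G l u * (φ u - c) ^ 2
      = mass G l φ - 2 * c * ∑ u, m0 G l u * φ u + c ^ 2 * ∑ u, m0 G l u := by
    rw [mass, Finset.mul_sum, Finset.mul_sum, ← Finset.sum_sub_distrib, ← Finset.sum_add_distrib]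
    exact Finset.sum_congr rfl fun u _ => by ring
  have := mul_nonneg (sq_nonneg c) (Finset.sum_nonneg fun u (_ : u ∈ Finset.univ) => hm u)
  rw [h, hφ]
  linarith

lemma mass_le_of_sq_sub_le (G : SimpleGraph V) {l : V → V → ℝ} (hm : ∀ u, 0 ≤ m0 G l u)
    (hl : ∀ u v, l u v ≤ 1) {φ : V → ℝ} (hφ : ∑ u, m0 G l u * φ u = 0) {c B : ℝ}
    (hB : ∀ u, (φ u - c) ^ 2 ≤ B) : mass G l φ ≤ (Fintype.card V : ℝ) ^ 2 * B :=
  calc mass G l φ ≤ ∑ u, m0 G l u * (φ u - c) ^ 2 := mass_le_sum_sq_sub G hm hφ c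
    _ ≤ ∑ _u : V, (Fintype.card V : ℝ) * B := Finset.sum_le_sum fun u _ =>
        mul_le_mul (m0_le_card G hl u) (hB u) (sq_nonneg _) (Nat.cast_nonneg _)
    _ = (Fintype.card V : ℝ) ^ 2 * B := by
        rw [Finset.sum_const, Finset.card_univ, nsmul_eq_mul]
        ring

lemma mass_pos (G : SimpleGraph V) {l : V → V → ℝ} (hm : ∀ u, 0 < m0 G l u) {φ : V → ℝ}
    (hφ : φ ≠ 0) : 0 < mass G l φ := by
  obtain ⟨u, hu⟩ := Function.ne_iff.mp hφ
  refine Finset.sum_pos' (fun v _ => mul_nonneg (hm v).le (sq_nonneg _)) ⟨u, Finset.mem_univ u, ?_⟩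
  exact mul_pos (hm u) (sq_pos_of_ne_zero hu)

/-- A Poincaré inequality for mean-zero functions bounds `lambda1` from below. -/
lemma le_lambda1 [Nontrivial V] (G : SimpleGraph V) {l : V → V → ℝ} (hm : ∀ u, 0 < m0 G l u)
    {c : ℝ} (h : ∀ φ : V → ℝ, ∑ u, m0 G l u * φ u = 0 → c * mass G l φ ≤ energy G l φ) :
    c ≤ lambda1 G l := by
  refine le_csInf ?_ ?_
  · obtain ⟨a, b, hab⟩ := exists_pair_ne V
    refine ⟨_, Pi.single a (m0 G l b) - Pi.single b (m0 G l a), fun h0 => ?_, ?_, rfl⟩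
    · have := congrFun h0 a
      simp [hab, (hm b).ne'] at this
    · simp [mul_sub, Finset.sum_sub_distrib, Pi.single_apply, mul_comm]
  · rintro r ⟨φ, hφ, h0, rfl⟩
    exact (le_div_iff₀ (mass_pos G hm hφ)).mpr (h φ h0)

lemma cycleLen_pos {n : ℕ} {t : ℝ} (ht : 0 < t) (i j : Fin n) : 0 < cycleLen n t i j := by
  unfold cycleLen
  split_ifs <;> linarith

lemma cycleLen_le_one {n : ℕ} {t : ℝ} (ht : t ≤ 1) (i j : Fin n) : cycleLen n t i j ≤ 1 := by
  unfold cycleLen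
  split_ifs <;> linarith

lemma cycleLen_zero_last {n : ℕ} (hn : 3 ≤ n) (t : ℝ) :
    cycleLen n t ⟨0, by omega⟩ ⟨n - 1, by omega⟩ = t := by
  rw [cycleLen, if_neg]
  dsimp only
  omega

lemma cycleLen_succ {n k : ℕ} (hk : k + 1 < n - 1) (t : ℝ) :
    cycleLen n t ⟨k + 1, by omega⟩ ⟨k, by omega⟩ = t := by
  rw [cycleLen, if_neg]
  dsimp only
  omega

lemma cycleGraph_adj_succ {n k : ℕ} (h : k + 1 < n) :
    (SimpleGraph.cycleGraph n).Adj ⟨k + 1, h⟩ ⟨k, by omega⟩ := by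
  rw [SimpleGraph.cycleGraph_adj']
  left
  rw [Fin.sub_val_of_le (by simp [Fin.le_def])]
  simp

lemma cycleGraph_adj_zero_last {n : ℕ} (h : 2 ≤ n) :
    (SimpleGraph.cycleGraph n).Adj ⟨0, by omega⟩ ⟨n - 1, by omega⟩ := by
  rw [SimpleGraph.cycleGraph_adj']
  left
  simp only [Fin.sub_def]
  rw [show n - (n - 1) + 0 = 1 by omega, Nat.mod_eq_of_lt (by omega)]

/-- If a function varies by at most `s` along the short edges of the cycle, following these edges
from the last vertex bounds its variation everywhere. -/
lemma abs_sub_last_le {n : ℕ} (hn : 3 ≤ n) {φ : Fin n → ℝ} {s : ℝ}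
    (h0 : |φ ⟨0, by omega⟩ - φ ⟨n - 1, by omega⟩| ≤ s)
    (hs : ∀ k (hk : k + 1 < n - 1), |φ ⟨k + 1, by omega⟩ - φ ⟨k, by omega⟩| ≤ s)
    (u : Fin n) : |φ u - φ ⟨n - 1, by omega⟩| ≤ n * s := by
  have hs0 : 0 ≤ s := (abs_nonneg _).trans h0
  have key : ∀ k (hk : k < n - 1),
      |φ ⟨k, by omega⟩ - φ ⟨n - 1, by omega⟩| ≤ (k + 1 : ℕ) * s := by
    intro k
    induction k with
    | zero => intro _; simpa using h0
    | succ k ih =>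
      intro hk
      have := abs_sub_le (φ ⟨k + 1, by omega⟩) (φ ⟨k, by omega⟩) (φ ⟨n - 1, by omega⟩)
      have h1 := ih (by omega)
      have h2 := hs k hk
      push_cast at h1 ⊢
      linarith
  obtain ⟨k, hk⟩ := u
  rcases Nat.lt_or_ge k (n - 1) with h | h
  · refine (key k h).trans ?_
    gcongr
    omega
  · obtain rfl : k = n - 1 := by omega
    simpa using mul_nonneg (Nat.cast_nonneg n) hs0

/-- The path of short edges is a spanning tree, so the energy controls all increments. -/
lemma sq_sub_last_le_energy {n : ℕ} (hn : 3 ≤ n) {t : ℝ} (ht : 0 < t) (φ : Fin n → ℝ)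
    (u : Fin n) : (φ u - φ ⟨n - 1, by omega⟩) ^ 2
      ≤ n ^ 2 * (2 * t * energy (SimpleGraph.cycleGraph n) (cycleLen n t) φ) := by
  have hE := energy_nonneg (SimpleGraph.cycleGraph n) (cycleLen_pos ht) φ
  have hvar : ∀ u v, (SimpleGraph.cycleGraph n).Adj u v → cycleLen n t u v = t →
      |φ u - φ v| ≤ √(2 * t * energy (SimpleGraph.cycleGraph n) (cycleLen n t) φ) := by
    intro u v huv hlt
    have h := sq_sub_le_energy _ (cycleLen_pos ht) φ huv
    rw [hlt] at h
    exact Real.abs_le_sqrt h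
  have habs := abs_sub_last_le hn
    (hvar _ _ (cycleGraph_adj_zero_last (by omega)) (cycleLen_zero_last hn t))
    (fun k hk => hvar _ _ (cycleGraph_adj_succ (by omega)) (cycleLen_succ hk t)) u
  rw [← Real.sq_sqrt (mul_nonneg (by positivity : 0 ≤ 2 * t) hE), ← mul_pow, ← sq_abs]
  exact pow_le_pow_left₀ (abs_nonneg _) habs 2

/-- For every `n ≥ 3` there are constants `C > 0` and `ε > 0` such that for all
`t ∈ (0, ε)`, the first nonzero eigenvalue of the Fujiwara Laplacian of the cycle `C_n`
with edge-length function `l_t` satisfies `λ₁(C_n, l_t) ≥ C/t`; in particular it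
diverges as `t → 0⁺`. -/
theorem cycleGraph_lambda1_lower_bound (n : ℕ) (hn : 3 ≤ n) :
    ∃ C > (0 : ℝ), ∃ ε > (0 : ℝ), ∀ t ∈ Set.Ioo (0 : ℝ) ε,
      C / t ≤ lambda1 (SimpleGraph.cycleGraph n) (cycleLen n t) := by
  have : Nontrivial (Fin n) := Fin.nontrivial_iff_two_le.mpr (by omega)
  have hn0 : (0 : ℝ) < n := by exact_mod_cast (by omega : 0 < n)
  refine ⟨1 / (2 * n ^ 4), by positivity, 1, one_pos, fun t ht => ?_⟩
  have ht0 := ht.1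
  have hm : ∀ u, 0 < m0 (SimpleGraph.cycleGraph n) (cycleLen n t) u := by
    rintro ⟨_ | k, hk⟩
    · exact m0_pos _ (cycleLen_pos ht0) (cycleGraph_adj_zero_last (by omega))
    · exact m0_pos _ (cycleLen_pos ht0) (cycleGraph_adj_succ hk)
  refine le_lambda1 _ hm fun φ hφ => ?_
  have h := mass_le_of_sq_sub_le _ (fun u => (hm u).le) (cycleLen_le_one ht.2.le) hφ
    (sq_sub_last_le_energy hn ht0 φ)
  rw [Fintype.card_fin] at h
  rw [div_div, one_div_mul_eq_div, div_le_iff₀ (by positivity)]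
  linarith

end
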